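/- arXiv:2002.08675 — 2 statements merged into one kernel-verified Lean document; each statement's English description precedes it below -/
import Mathlib

section
/- Let d, d' be positive integers with d' ≤ d, let U and Ũ be d × d' real matrices with orthonormal columns, and let ε ≥ 0. If the spectral (operator) norm satisfies ‖U − Ũ‖₂ ≤ ε, then the Frobenius norm of the difference of the corresponding orthogonal projection matrices satisfies ‖U Uᵀ − Ũ Ũᵀ‖_F ≤ 2√2 · √(d') · ε. (Deterministic core of Lemma 2: applied with ε = E(δ)/(λ_{d'} − λ_{d'+1}), it yields the bound ‖U Uᵀ − Ũ Ũᵀ‖_F ≤ 2√2 E(δ) √(d')/(λ_{d'} − λ_{d'+1}).) -/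
open Matrix

/-- Frobenius norm of a real matrix. -/
noncomputable def frobNorm {m n : ℕ} (M : Matrix (Fin m) (Fin n) ℝ) : ℝ :=
  Real.sqrt (∑ i, ∑ j, (M i j) ^ 2)

/-- Spectral (operator) norm of a real matrix, i.e. the operator norm of the
induced linear map between Euclidean spaces. -/
noncomputable def specNorm {m n : ℕ} (M : Matrix (Fin m) (Fin n) ℝ) : ℝ :=
  ‖LinearMap.toContinuousLinearMap (Matrix.toEuclideanLin M)‖

theorem sum_sq_eq_trace {m n : ℕ} (M : Matrix (Fin m) (Fin n) ℝ) :
    ∑ i, ∑ j, (M i j) ^ 2 = (Mᵀ * M).trace := by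
  simp only [Matrix.trace, Matrix.diag_apply, Matrix.mul_apply, Matrix.transpose_apply, pow_two]
  exact Finset.sum_comm

theorem sum_col_sq_le_specNorm_sq {m n : ℕ} (M : Matrix (Fin m) (Fin n) ℝ) (j : Fin n) :
    ∑ i, (M i j) ^ 2 ≤ specNorm M ^ 2 := by
  have h := (LinearMap.toContinuousLinearMap (Matrix.toEuclideanLin M)).le_opNorm
    (EuclideanSpace.single j 1)
  have h2 := pow_le_pow_left₀ (norm_nonneg _) h 2
  simpa [EuclideanSpace.norm_sq_eq, specNorm, Matrix.toLpLin_apply] using h2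

/-- The squared Frobenius norm is at most the number of columns times the squared spectral norm. -/
theorem sum_sq_le_card_mul_specNorm_sq {m n : ℕ} (M : Matrix (Fin m) (Fin n) ℝ) :
    ∑ i, ∑ j, (M i j) ^ 2 ≤ n * specNorm M ^ 2 := by
  rw [Finset.sum_comm]
  simpa using Finset.sum_le_sum fun j (_ : j ∈ Finset.univ) => sum_col_sq_le_specNorm_sq M j

/-- Replacing matrices with orthonormal columns by their column projections at most doubles the
squared Frobenius distance. -/
theorem sum_sq_proj_sub_le {m n : ℕ} (U V : Matrix (Fin m) (Fin n) ℝ)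
    (hU : Uᵀ * U = 1) (hV : Vᵀ * V = 1) :
    ∑ i, ∑ j, ((U * Uᵀ - V * Vᵀ) i j) ^ 2 ≤ 2 * ∑ i, ∑ j, ((U - V) i j) ^ 2 := by
  have hM : 0 ≤ ∑ i, ∑ j, ((Uᵀ * V - 1 : Matrix (Fin n) (Fin n) ℝ) i j) ^ 2 := by positivity
  rw [sum_sq_eq_trace] at hM ⊢
  rw [sum_sq_eq_trace]
  have e1 : (U * Uᵀ * (U * Uᵀ)).trace = n := by
    rw [Matrix.mul_assoc, ← Matrix.mul_assoc Uᵀ, hU, Matrix.one_mul, Matrix.trace_mul_comm, hU]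
    simp
  have e2 : (V * Vᵀ * (V * Vᵀ)).trace = n := by
    rw [Matrix.mul_assoc, ← Matrix.mul_assoc Vᵀ, hV, Matrix.one_mul, Matrix.trace_mul_comm, hV]
    simp
  have e3 : (V * Vᵀ * (U * Uᵀ)).trace = (Vᵀ * U * (Uᵀ * V)).trace := by
    rw [Matrix.mul_assoc, Matrix.trace_mul_comm]
    simp only [Matrix.mul_assoc]
  have e4 : (U * Uᵀ * (V * Vᵀ)).trace = (Vᵀ * U * (Uᵀ * V)).trace := by
    rw [Matrix.trace_mul_comm, e3]
  have e5 : (Vᵀ * U).trace = (Uᵀ * V).trace := by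
    rw [← Matrix.trace_transpose]
    simp
  simp only [Matrix.transpose_sub, Matrix.transpose_mul, Matrix.transpose_transpose,
    Matrix.transpose_one, Matrix.sub_mul, Matrix.mul_sub, Matrix.trace_sub, Matrix.mul_one,
    Matrix.one_mul, hU, hV, e1, e2, e3, e4, e5, Matrix.trace_one, Fintype.card_fin] at hM ⊢
  linarith


/-- Deterministic core of Lemma 2: if `U`, `Ũ` are `d × d'` matrices with
orthonormal columns and the spectral norm of their difference is at most `ε ≥ 0`,
then the Frobenius norm of the difference of the associated orthogonal
projection matrices is at most `2√2 · √d' · ε`. -/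
theorem stmt_0 (d d' : ℕ) (hd : 0 < d) (hd' : 0 < d') (hdd : d' ≤ d)
    (U Ut : Matrix (Fin d) (Fin d') ℝ)
    (hU : Uᵀ * U = 1) (hUt : Utᵀ * Ut = 1)
    (ε : ℝ) (hε : 0 ≤ ε)
    (hspec : specNorm (U - Ut) ≤ ε) :
    frobNorm (U * Uᵀ - Ut * Utᵀ) ≤ 2 * Real.sqrt 2 * Real.sqrt d' * ε := by
  have h0 : 0 ≤ specNorm (U - Ut) := norm_nonneg _
  have hsq := pow_le_pow_left₀ h0 hspec 2
  have hF := sum_sq_le_card_mul_specNorm_sq (U - Ut)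
  have hP := sum_sq_proj_sub_le U Ut hU hUt
  have hn : (0 : ℝ) ≤ d' := Nat.cast_nonneg _
  have hmul := mul_le_mul_of_nonneg_left hsq hn
  refine Real.sqrt_le_iff.mpr ⟨by positivity, ?_⟩
  rw [mul_pow, mul_pow, mul_pow, Real.sq_sqrt hn, Real.sq_sqrt zero_le_two]
  nlinarith [mul_nonneg hn (sq_nonneg ε)]
end

section
/- Let d, d' be positive integers with d' ≤ d, let U_s, Ũ_s, U_t, Ũ_t be d × d' real matrices with orthonormal columns, let g_s > 0, g_t > 0 and E ≥ 0. Define the error index e(d') = √(d')/g_s + √(d')/g_t. If ‖U_s − Ũ_s‖₂ ≤ E/g_s and ‖U_t − Ũ_t‖₂ ≤ E/g_t, then | ‖U_s U_sᵀ − U_t U_tᵀ‖_F − ‖Ũ_s Ũ_sᵀ − Ũ_t Ũ_tᵀ‖_F | ≤ 2√2 · E · e(d'). (This is the deterministic core of Theorem 3, where g_s = λ_{d'}^s − λ_{d'+1}^s and g_t = λ_{d'}^t − λ_{d'+1}^t are the domain-specific eigenvalue gaps and the hypotheses hold with probability at least 1 − δ by Theorem 1 with E = E(δ).) -/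
open Matrix

section FrobeniusNorm

attribute [local instance] Matrix.frobeniusNormedAddCommGroup

lemma frobNorm_eq_norm {m n : ℕ} (M : Matrix (Fin m) (Fin n) ℝ) : frobNorm M = ‖M‖ := by
  rw [Matrix.frobenius_norm_def, frobNorm, Real.sqrt_eq_rpow]
  simp

lemma frobNorm_add_le {m n : ℕ} (A B : Matrix (Fin m) (Fin n) ℝ) :
    frobNorm (A + B) ≤ frobNorm A + frobNorm B := by
  simpa only [frobNorm_eq_norm] using norm_add_le A B

lemma abs_frobNorm_sub_frobNorm_le {m n : ℕ} (A B : Matrix (Fin m) (Fin n) ℝ) :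
    |frobNorm A - frobNorm B| ≤ frobNorm (A - B) := by
  simpa only [frobNorm_eq_norm] using abs_norm_sub_norm_le A B

lemma frobNorm_sub_le {m n : ℕ} (A B : Matrix (Fin m) (Fin n) ℝ) :
    frobNorm (A - B) ≤ frobNorm A + frobNorm B := by
  simpa only [frobNorm_eq_norm] using norm_sub_le A B

lemma frobNorm_transpose {m n : ℕ} (A : Matrix (Fin m) (Fin n) ℝ) :
    frobNorm Aᵀ = frobNorm A := by
  simpa only [frobNorm_eq_norm] using Matrix.frobenius_norm_transpose A

end FrobeniusNorm

lemma frobNorm_eq_sqrt_trace {m n : ℕ} (A : Matrix (Fin m) (Fin n) ℝ) :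
    frobNorm A = Real.sqrt (Aᵀ * A).trace := by
  rw [frobNorm, Finset.sum_comm]
  simp [Matrix.trace, Matrix.mul_apply, sq]

/-- Left multiplication by a column-orthonormal matrix preserves the Frobenius norm. -/
lemma frobNorm_mul_of_transpose_mul_self {m n k : ℕ} {U : Matrix (Fin m) (Fin n) ℝ}
    (hU : Uᵀ * U = 1) (A : Matrix (Fin n) (Fin k) ℝ) : frobNorm (U * A) = frobNorm A := by
  rw [frobNorm_eq_sqrt_trace, frobNorm_eq_sqrt_trace, Matrix.transpose_mul, Matrix.mul_assoc,
    ← Matrix.mul_assoc Uᵀ, hU, Matrix.one_mul]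

lemma sum_sq_col_le_specNorm_sq {m n : ℕ} (A : Matrix (Fin m) (Fin n) ℝ) (j : Fin n) :
    ∑ i, (A i j) ^ 2 ≤ specNorm A ^ 2 := by
  have h := (LinearMap.toContinuousLinearMap (Matrix.toEuclideanLin A)).le_opNorm
    (EuclideanSpace.single j 1)
  have h2 := pow_le_pow_left₀ (norm_nonneg _) h 2
  rw [EuclideanSpace.norm_sq_eq] at h2
  simpa [specNorm, Matrix.toLpLin_apply] using h2

lemma frobNorm_le_sqrt_mul_specNorm {m n : ℕ} (A : Matrix (Fin m) (Fin n) ℝ) :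
    frobNorm A ≤ Real.sqrt n * specNorm A := by
  have h0 : 0 ≤ specNorm A := norm_nonneg _
  rw [frobNorm, Finset.sum_comm]
  refine Real.sqrt_le_iff.mpr ⟨by positivity, ?_⟩
  rw [mul_pow, Real.sq_sqrt (Nat.cast_nonneg n)]
  simpa using Finset.sum_le_sum fun j (_ : j ∈ Finset.univ) => sum_sq_col_le_specNorm_sq A j

/-- The Frobenius distance of two projectors is controlled by the spectral distance of
column-orthonormal bases of their ranges. -/
lemma frobNorm_projection_sub_le {m n : ℕ} {U V : Matrix (Fin m) (Fin n) ℝ}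
    (hU : Uᵀ * U = 1) (hV : Vᵀ * V = 1) :
    frobNorm (U * Uᵀ - V * Vᵀ) ≤ 2 * (Real.sqrt n * specNorm (U - V)) := by
  have hsplit : U * Uᵀ - V * Vᵀ = U * (U - V)ᵀ + (V * (U - V)ᵀ)ᵀ := by
    simp only [Matrix.transpose_mul, Matrix.transpose_transpose, Matrix.transpose_sub,
      Matrix.mul_sub]
    abel
  calc frobNorm (U * Uᵀ - V * Vᵀ)
      ≤ frobNorm (U * (U - V)ᵀ) + frobNorm (V * (U - V)ᵀ)ᵀ := by
        rw [hsplit]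
        exact frobNorm_add_le _ _
    _ = 2 * frobNorm (U - V) := by
        rw [frobNorm_transpose, frobNorm_mul_of_transpose_mul_self hU,
          frobNorm_mul_of_transpose_mul_self hV, frobNorm_transpose, two_mul]
    _ ≤ 2 * (Real.sqrt n * specNorm (U - V)) := by
        gcongr
        exact frobNorm_le_sqrt_mul_specNorm _

/-- Deterministic core of Theorem 3: with eigenvalue gaps `g_s, g_t > 0`,
error level `E ≥ 0` and error index `e(d') = √d'/g_s + √d'/g_t`, if the
column-orthonormal bases of the true and empirical dominant subspaces are
spectrally close, then the Grassmannian distances (Frobenius distances of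
projectors) differ by at most `2√2 · E · e(d')`. -/
theorem stmt_1 (d d' : ℕ) (hd : 0 < d) (hd' : 0 < d') (hdd : d' ≤ d)
    (Us Uts Ut Utt : Matrix (Fin d) (Fin d') ℝ)
    (hUs : Usᵀ * Us = 1) (hUts : Utsᵀ * Uts = 1)
    (hUt : Utᵀ * Ut = 1) (hUtt : Uttᵀ * Utt = 1)
    (gs gt E : ℝ) (hgs : 0 < gs) (hgt : 0 < gt) (hE : 0 ≤ E)
    (hs : specNorm (Us - Uts) ≤ E / gs)
    (ht : specNorm (Ut - Utt) ≤ E / gt) :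
    |frobNorm (Us * Usᵀ - Ut * Utᵀ) - frobNorm (Uts * Utsᵀ - Utt * Uttᵀ)| ≤
      2 * Real.sqrt 2 * E * (Real.sqrt d' / gs + Real.sqrt d' / gt) := by
  have hs' : frobNorm (Us * Usᵀ - Uts * Utsᵀ) ≤ 2 * (Real.sqrt d' * (E / gs)) :=
    (frobNorm_projection_sub_le hUs hUts).trans (by gcongr)
  have ht' : frobNorm (Ut * Utᵀ - Utt * Uttᵀ) ≤ 2 * (Real.sqrt d' * (E / gt)) :=
    (frobNorm_projection_sub_le hUt hUtt).trans (by gcongr)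
  have hsqrt : 1 ≤ Real.sqrt 2 := Real.one_le_sqrt.mpr one_le_two
  calc |frobNorm (Us * Usᵀ - Ut * Utᵀ) - frobNorm (Uts * Utsᵀ - Utt * Uttᵀ)|
      ≤ frobNorm ((Us * Usᵀ - Ut * Utᵀ) - (Uts * Utsᵀ - Utt * Uttᵀ)) :=
        abs_frobNorm_sub_frobNorm_le _ _
    _ = frobNorm ((Us * Usᵀ - Uts * Utsᵀ) - (Ut * Utᵀ - Utt * Uttᵀ)) := by
        rw [sub_sub_sub_comm]
    _ ≤ 2 * (Real.sqrt d' * (E / gs)) + 2 * (Real.sqrt d' * (E / gt)) :=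
        (frobNorm_sub_le _ _).trans (add_le_add hs' ht')
    _ = 2 * 1 * E * (Real.sqrt d' / gs + Real.sqrt d' / gt) := by ring
    _ ≤ 2 * Real.sqrt 2 * E * (Real.sqrt d' / gs + Real.sqrt d' / gt) := by gcongr
end
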